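/- Let H be a Hilbert space and A the generator of a bounded C₀-semigroup (T(t))_{t≥0} with iℝ ⊂ ρ(A). If ‖(isI − A)⁻¹‖ = O(|s|^α) as |s| → ∞ for some fixed α > 0, then ‖T(t)A⁻¹‖ = O(t^{−1/α}) as t → ∞; in particular, for every Φ₀ ∈ D(A), ‖T(t)Φ₀‖ ≤ M t^{−1/α} ‖Φ₀‖_{D(A)} for t > 0. -/

import Mathlib

open Filter Topology

open MeasureTheory FourierTransform SchwartzMap in
theorem integral_schwartz_smul_fourierTransformₗᵢ {H : Type*} [NormedAddCommGroup H]
    [InnerProductSpace ℂ H] [CompleteSpace H] {f : ℝ → H} (hf : Integrable f)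
    (F : Lp H 2 (volume : Measure ℝ)) (hF : F =ᵐ[volume] f) (g : 𝓢(ℝ, ℂ)) :
    ∫ x, g x • Lp.fourierTransformₗᵢ ℝ H F x = ∫ x, g x • 𝓕 f x := by
  have h1 := congrArg (fun u => u g) (Lp.fourier_toTemperedDistribution_eq F)
  simp only [TemperedDistribution.fourier_apply, Lp.toTemperedDistribution_apply] at h1
  have h2 : ∫ x, 𝓕 (g : ℝ → ℂ) x • f x = ∫ x, g x • 𝓕 f x := by
    have := VectorFourier.integral_fourierIntegral_smul_eq_flip (L := innerₗ ℝ)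
      Real.continuous_fourierChar continuous_inner (g.integrable (μ := volume)) hf
    rwa [flip_innerₗ] at this
  have h3 : ∫ x, (𝓕 g) x • F x = ∫ x, 𝓕 (g : ℝ → ℂ) x • f x := by
    apply integral_congr_ae
    filter_upwards [hF] with x hx
    rw [hx, fourier_coe]
  exact h1.symm.trans (h3.trans h2)

open MeasureTheory SchwartzMap ContDiff in
theorem ae_eq_of_integral_schwartz_smul_eq {H : Type*} [NormedAddCommGroup H]
    [InnerProductSpace ℂ H] [CompleteSpace H] {u v : ℝ → H} (hu : LocallyIntegrable u)
    (hv : LocallyIntegrable v) (h : ∀ g : 𝓢(ℝ, ℂ), ∫ x, g x • u x = ∫ x, g x • v x) :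
    u =ᵐ[volume] v := by
  apply ae_eq_of_integral_contDiff_smul_eq hu hv
  intro g hg hgs
  have hg₁ : HasCompactSupport (Complex.ofRealCLM ∘ g) := hgs.comp_left rfl
  have hg₂ : ContDiff ℝ ∞ (Complex.ofRealCLM ∘ g) := by fun_prop
  simpa using h (hg₁.toSchwartzMap hg₂)

open MeasureTheory FourierTransform in
theorem fourierTransformₗᵢ_ae_eq {H : Type*} [NormedAddCommGroup H] [InnerProductSpace ℂ H]
    [CompleteSpace H] {f : ℝ → H} (hf : Integrable f) (F : Lp H 2 (volume : Measure ℝ))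
    (hF : F =ᵐ[volume] f) :
    Lp.fourierTransformₗᵢ ℝ H F =ᵐ[volume] 𝓕 f :=
  ae_eq_of_integral_schwartz_smul_eq
    ((Lp.memLp (Lp.fourierTransformₗᵢ ℝ H F)).locallyIntegrable one_le_two)
    (VectorFourier.fourierIntegral_continuous Real.continuous_fourierChar
      continuous_inner hf).locallyIntegrable
    (integral_schwartz_smul_fourierTransformₗᵢ hf F hF)

open MeasureTheory FourierTransform in
theorem eLpNorm_fourier {H : Type*} [NormedAddCommGroup H] [InnerProductSpace ℂ H]
    [CompleteSpace H] {f : ℝ → H} (hf : Integrable f) (hf2 : MemLp f 2) :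
    eLpNorm (𝓕 f) 2 = eLpNorm f 2 := by
  have h := (Lp.fourierTransformₗᵢ ℝ H).norm_map (hf2.toLp f)
  rw [Lp.norm_def, Lp.norm_def,
    ENNReal.toReal_eq_toReal_iff' (Lp.memLp _).2.ne (Lp.memLp _).2.ne] at h
  rwa [eLpNorm_congr_ae (fourierTransformₗᵢ_ae_eq hf _ hf2.coeFn_toLp),
    eLpNorm_congr_ae hf2.coeFn_toLp] at h

/-- `T` is a C₀-semigroup bounded by `C` whose generator extends `A`, and `R s` is the inverse of
`is - A` for every real `s`. -/
structure IsBoundedSemigroup {H : Type*} [NormedAddCommGroup H] [InnerProductSpace ℂ H]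
    (A : H →ₗ.[ℂ] H) (T : ℝ → H →L[ℂ] H) (R : ℝ → H →L[ℂ] H) (C : ℝ) : Prop where
  zero : T 0 = ContinuousLinearMap.id ℂ H
  add : ∀ s t : ℝ, 0 ≤ s → 0 ≤ t → T (s + t) = (T s).comp (T t)
  continuousOn : ∀ x : H, ContinuousOn (fun t => T t x) (Set.Ici 0)
  one_le : 1 ≤ C
  bound : ∀ t : ℝ, 0 ≤ t → ‖T t‖ ≤ C
  hasDerivAt : ∀ x : A.domain, HasDerivAt (fun t => T t (x : H)) (A x) 0
  resolvent : ∀ s : ℝ, (∀ x : A.domain, R s ((Complex.I * s) • (x : H) - A x) = (x : H)) ∧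
    ∀ y : H, ∃ h : R s y ∈ A.domain, (Complex.I * s) • (R s y) - A ⟨R s y, h⟩ = y

namespace IsBoundedSemigroup

variable {H : Type*} [NormedAddCommGroup H] [InnerProductSpace ℂ H]
  {A : H →ₗ.[ℂ] H} {T : ℝ → H →L[ℂ] H} {R : ℝ → H →L[ℂ] H} {C : ℝ}

theorem hasDerivWithinAt_orbit (h : IsBoundedSemigroup A T R C) {u v : H}
    (huv : HasDerivWithinAt (fun t => T t u) v (Set.Ici 0) 0) {s : ℝ} (hs : 0 ≤ s) :
    HasDerivWithinAt (fun t => T t u) (T s v) (Set.Ici s) s := by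
  have h1 : HasDerivWithinAt (fun t : ℝ => t - s) 1 (Set.Ici s) s :=
    (hasDerivWithinAt_id s _).sub_const s
  have h2 : HasDerivWithinAt (fun t => T t u) v (Set.Ici 0) (s - s) := by simpa using huv
  have h3 := HasDerivWithinAt.scomp (h := fun t : ℝ => t - s) s h2 h1
    (fun t ht => sub_nonneg.2 (Set.mem_Ici.1 ht))
  have h4 := ((T s).restrictScalars ℝ).hasFDerivAt.comp_hasDerivWithinAt s h3
  simp only [one_smul] at h4
  refine h4.congr (fun t ht => ?_) ?_
  · have := h.add s (t - s) hs (by simpa using ht)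
    rw [add_sub_cancel] at this
    simp [this]
  · simp [h.zero]

theorem hasDerivWithinAt_orbit_domain (h : IsBoundedSemigroup A T R C) (x : A.domain) {s : ℝ}
    (hs : 0 ≤ s) : HasDerivWithinAt (fun t => T t (x : H)) (T s (A x)) (Set.Ici s) s :=
  h.hasDerivWithinAt_orbit (h.hasDerivAt x).hasDerivWithinAt hs

theorem eq_zero_of_forall_apply_eq [CompleteSpace H] (h : IsBoundedSemigroup A T R C) {d : H}
    (hd : ∀ t, 0 ≤ t → T t d = d) : d = 0 := by
  obtain ⟨ε, hε, hε1⟩ : ∃ ε : ℝ, 0 < ε ∧ ε * ‖R 0‖ < 1 := by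
    refine ⟨1 / (‖R 0‖ + 1), by positivity, ?_⟩
    rw [one_div, inv_mul_lt_one₀ (by positivity)]
    linarith
  have hR0 := h.resolvent 0
  have hn : ‖-((ε : ℂ) • R 0)‖ < 1 := by
    rw [norm_neg, norm_smul]
    simpa [abs_of_pos hε] using hε1
  set U := Units.oneSub _ hn
  obtain ⟨q, hq⟩ : ∃ q : H, q + (ε : ℂ) • R 0 q = d := by
    have : ((U : H →L[ℂ] H) * (↑U⁻¹ : H →L[ℂ] H)) d = d := by simp
    exact ⟨(↑U⁻¹ : H →L[ℂ] H) d, by simpa [U] using this⟩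
  obtain ⟨hpD, hAp⟩ := hR0.2 q
  set p : A.domain := ⟨R 0 q, hpD⟩
  have hAp' : A p = (ε : ℂ) • (p : H) - d := by
    have : A p = -q := by rw [← neg_eq_iff_eq_neg]; simpa using hAp
    rw [this, ← hq]
    simp [p]
  -- the vector `ε p - d` grows exponentially along the bounded semigroup
  have hder : ∀ s, 0 ≤ s → HasDerivWithinAt
      (fun t : ℝ => Real.exp (-(ε * t)) • (T t ((ε : ℂ) • (p : H) - d))) 0 (Set.Ici s) s := by
    intro s hs
    have h1 : HasDerivWithinAt (fun t : ℝ => Real.exp (-(ε * t)))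
        (Real.exp (-(ε * s)) * (-(ε * 1))) (Set.Ici s) s :=
      (((hasDerivAt_id s).const_mul ε).neg.exp).hasDerivWithinAt
    have h2 := (h.hasDerivWithinAt_orbit_domain p hs).const_smul (ε : ℂ)
    have h3 : HasDerivWithinAt (fun t => T t ((ε : ℂ) • (p : H) - d)) ((ε : ℂ) • T s (A p))
        (Set.Ici s) s := by
      refine (h2.sub_const d).congr (fun t ht => ?_) ?_
      · simp [hd t (hs.trans ht)]
      · simp [hd s hs]
    refine (h1.smul h3).congr_deriv ?_
    rw [hAp', Complex.coe_smul]
    module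
  have hcont : ContinuousOn
      (fun t : ℝ => Real.exp (-(ε * t)) • (T t ((ε : ℂ) • (p : H) - d))) (Set.Ici 0) := by
    have h1 : Continuous (fun t : ℝ => Real.exp (-(ε * t))) := by fun_prop
    exact h1.continuousOn.smul (h.continuousOn _)
  have hconst : ∀ t, 0 ≤ t → T t (A p) = Real.exp (ε * t) • A p := by
    intro t ht
    have := constant_of_has_deriv_right_zero (hcont.mono Set.Icc_subset_Ici_self)
      (fun s hs => hder s hs.1) t ⟨ht, le_rfl⟩
    simp only [mul_zero, neg_zero, Real.exp_zero, one_smul, h.zero,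
      ContinuousLinearMap.id_apply] at this
    rw [hAp', ← this, smul_smul, ← Real.exp_add, this]
    simp
  have hAp0 : A p = 0 := by
    by_contra hne
    have hpos : 0 < ‖A p‖ := norm_pos_iff.2 hne
    have hb : ∀ t, 0 ≤ t → Real.exp (ε * t) ≤ C := by
      intro t ht
      have h1 := (T t).le_of_opNorm_le (h.bound t ht) (A p)
      rw [hconst t ht, norm_smul, Real.norm_of_nonneg (Real.exp_pos _).le] at h1
      exact le_of_mul_le_mul_right h1 hpos
    have h2 := hb (C / ε) (div_nonneg (by linarith [h.one_le]) hε.le)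
    rw [mul_div_cancel₀ _ hε.ne'] at h2
    linarith [Real.add_one_le_exp C]
  have hp0 : (p : H) = 0 := by
    have := hR0.1 p
    rw [← this, hAp0]
    simp
  rw [hAp0, hp0] at hAp'
  simpa using hAp'.symm

theorem mem_domain_of_hasDerivWithinAt [CompleteSpace H] (h : IsBoundedSemigroup A T R C) {u v : H}
    (huv : HasDerivWithinAt (fun t => T t u) v (Set.Ici 0) 0) :
    ∃ hu : u ∈ A.domain, A ⟨u, hu⟩ = v := by
  obtain ⟨hwD, hAw⟩ := (h.resolvent 0).2 (-v)
  set w : A.domain := ⟨R 0 (-v), hwD⟩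
  have hAw' : A w = v := by simpa using hAw
  have hd : u - w = 0 := by
    apply h.eq_zero_of_forall_apply_eq
    intro t ht
    have h1 : HasDerivWithinAt (fun t => T t (u - w)) 0 (Set.Ici 0) 0 := by
      have h2 := huv.sub (h.hasDerivAt w).hasDerivWithinAt
      rw [hAw', sub_self] at h2
      exact h2.congr (fun t _ => by simp) (by simp)
    have := constant_of_has_deriv_right_zero
      ((h.continuousOn (u - w)).mono Set.Icc_subset_Ici_self)
      (fun s hs => by simpa using h.hasDerivWithinAt_orbit h1 hs.1) t ⟨ht, le_rfl⟩
    simpa only [h.zero, ContinuousLinearMap.id_apply] using this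
  have hu : u = w := sub_eq_zero.1 hd
  subst hu
  exact ⟨w.2, hAw'⟩

theorem resolvent_comm [CompleteSpace H] (h : IsBoundedSemigroup A T R C) (s : ℝ) {t : ℝ}
    (ht : 0 ≤ t) (z : H) : R s (T t z) = T t (R s z) := by
  obtain ⟨hD, hA⟩ := (h.resolvent s).2 z
  set x : A.domain := ⟨R s z, hD⟩
  have h1 : HasDerivWithinAt (fun r => T r (T t (x : H))) (T t (A x)) (Set.Ici 0) 0 := by
    have h2 := ((T t).restrictScalars ℝ).hasFDerivAt.comp_hasDerivWithinAt 0
      (h.hasDerivAt x).hasDerivWithinAt (s := Set.Ici 0)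
    refine h2.congr (fun r hr => ?_) ?_
    · have e1 := h.add r t hr ht
      have e2 := h.add t r ht hr
      rw [add_comm, e2] at e1
      simpa using (congrArg (fun L => L (x : H)) e1).symm
    · simp [h.zero]
  obtain ⟨hD', hA'⟩ := h.mem_domain_of_hasDerivWithinAt h1
  have h3 := (h.resolvent s).1 ⟨_, hD'⟩
  rw [hA'] at h3
  have h4 : (Complex.I * s) • T t (x : H) - T t (A x) = T t z := by
    rw [← map_smul, ← map_sub]
    exact congrArg (T t) hA
  rw [← h4]
  exact h3

theorem resolvent_identity (h : IsBoundedSemigroup A T R C) (s r : ℝ) (y : H) :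
    R r y = R s y + (Complex.I * (s - r)) • R s (R r y) := by
  obtain ⟨hD, hA⟩ := (h.resolvent r).2 y
  have h1 := (h.resolvent s).1 ⟨_, hD⟩
  have h2 : (Complex.I * s) • R r y - A ⟨_, hD⟩ = y + (Complex.I * (s - r)) • R r y := by
    rw [eq_sub_of_add_eq' (sub_eq_iff_eq_add.1 hA).symm]
    module
  rw [h2] at h1
  simpa using h1.symm

end IsBoundedSemigroup

/-- The orbit `s ↦ T s z` on the positive half-line, localised by the weight `φ`. -/
def weightedOrbit {H : Type*} [NormedAddCommGroup H] [InnerProductSpace ℂ H]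
    (T : ℝ → H →L[ℂ] H) (φ : ℝ → ℝ) (z : H) : ℝ → H :=
  fun s => (φ s : ℂ) • T (max s 0) z

namespace IsBoundedSemigroup

variable {H : Type*} [NormedAddCommGroup H] [InnerProductSpace ℂ H]
  {A : H →ₗ.[ℂ] H} {T : ℝ → H →L[ℂ] H} {R : ℝ → H →L[ℂ] H} {C : ℝ}

theorem exists_resolvent_bound (h : IsBoundedSemigroup A T R C) {α : ℝ} (hα : 0 < α)
    {K s₀ : ℝ} (hK : ∀ s : ℝ, s₀ ≤ |s| → ‖R s‖ ≤ K * |s| ^ α) :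
    ∃ L : ℝ, 1 ≤ L ∧ ∀ s : ℝ, ‖R s‖ ≤ L * (1 + |s|) ^ α := by
  have hloc : ∀ s : ℝ, ∀ r : ℝ, |s - r| * ‖R s‖ ≤ 1 / 2 → ‖R r‖ ≤ 2 * ‖R s‖ := by
    intro s r hsr
    have h1 : R r = R s + (Complex.I * (s - r)) • (R s).comp (R r) := by
      ext y
      simpa using h.resolvent_identity s r y
    have h2 : ‖R r‖ ≤ ‖R s‖ + |s - r| * (‖R s‖ * ‖R r‖) := by
      calc ‖R r‖ = ‖R s + (Complex.I * (s - r)) • (R s).comp (R r)‖ := by rw [← h1]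
        _ ≤ ‖R s‖ + ‖(Complex.I * (s - r)) • (R s).comp (R r)‖ := norm_add_le _ _
        _ ≤ _ := by
          rw [norm_smul]
          have : ‖Complex.I * ((s : ℂ) - r)‖ = |s - r| := by
            rw [norm_mul, Complex.norm_I, one_mul, ← Complex.ofReal_sub, Complex.norm_real,
              Real.norm_eq_abs]
          rw [this]
          gcongr
          exact ContinuousLinearMap.opNorm_comp_le _ _
    nlinarith [mul_le_mul_of_nonneg_right hsr (norm_nonneg (R r))]
  obtain ⟨B, hB⟩ : ∃ B : ℝ, ∀ s ∈ Set.Icc (-s₀) s₀, ‖R s‖ ≤ B := by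
    refine isCompact_Icc.induction_on (p := fun S => ∃ B : ℝ, ∀ s ∈ S, ‖R s‖ ≤ B) ⟨0, by simp⟩
      (fun S S' hS ⟨B, hB⟩ => ⟨B, fun s hs => hB s (hS hs)⟩)
      (fun S S' ⟨B, hB⟩ ⟨B', hB'⟩ => ⟨max B B', fun s hs => ?_⟩) (fun s _ => ?_)
    · rcases hs with hs | hs
      · exact (hB s hs).trans (le_max_left _ _)
      · exact (hB' s hs).trans (le_max_right _ _)
    · have hc : Tendsto (fun r : ℝ => |s - r| * ‖R s‖) (𝓝 s) (𝓝 0) := by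
        have : Continuous (fun r : ℝ => |s - r| * ‖R s‖) := by fun_prop
        simpa using this.tendsto s
      refine ⟨_, mem_nhdsWithin_of_mem_nhds (hc.eventually_le_const (by norm_num : (0 : ℝ) < 1 / 2)),
        2 * ‖R s‖, fun r hr => hloc s r hr⟩
  refine ⟨max 1 (max B K), le_max_left _ _, fun s => ?_⟩
  have hpow : 1 ≤ (1 + |s|) ^ α := Real.one_le_rpow (by linarith [abs_nonneg s]) hα.le
  rcases le_total s₀ |s| with hs | hs
  · refine (hK s hs).trans ?_
    have h1 : |s| ^ α ≤ (1 + |s|) ^ α := by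
      gcongr
      linarith
    have h2 : K ≤ max 1 (max B K) := (le_max_right _ _).trans (le_max_right _ _)
    have h3 : 0 ≤ |s| ^ α := by positivity
    calc K * |s| ^ α ≤ max 1 (max B K) * |s| ^ α := by gcongr
      _ ≤ _ := by gcongr
  · have h2 : B ≤ max 1 (max B K) := (le_max_left _ _).trans (le_max_right _ _)
    calc ‖R s‖ ≤ B := hB s (abs_le.1 hs)
      _ ≤ max 1 (max B K) * 1 := by simp
      _ ≤ _ := by gcongr

theorem continuous_orbit (h : IsBoundedSemigroup A T R C) (z : H) :
    Continuous fun s => T (max s 0) z :=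
  (h.continuousOn z).comp_continuous (by fun_prop) fun s => le_max_right s 0

theorem continuous_weightedOrbit (h : IsBoundedSemigroup A T R C) {φ : ℝ → ℝ}
    (hφ : Continuous φ) (z : H) : Continuous (weightedOrbit T φ z) :=
  (Complex.continuous_ofReal.comp hφ).smul (h.continuous_orbit z)

theorem hasCompactSupport_weightedOrbit {φ : ℝ → ℝ} {b : ℝ}
    (hφ : ∀ s, s ∉ Set.Ioo 0 b → φ s = 0) (z : H) :
    HasCompactSupport (weightedOrbit T φ z) :=
  HasCompactSupport.intro (isCompact_Icc (a := 0) (b := b)) fun s hs => by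
    simp [weightedOrbit, hφ s fun hs' => hs ⟨hs'.1.le, hs'.2.le⟩]

theorem integrable_exp_smul_weightedOrbit (h : IsBoundedSemigroup A T R C) {φ : ℝ → ℝ} {b : ℝ}
    (hφc : Continuous φ) (hφ : ∀ s, s ∉ Set.Ioo 0 b → φ s = 0) (z : H) (ξ : ℝ) :
    MeasureTheory.Integrable fun v : ℝ =>
      Complex.exp (↑(-2 * Real.pi * v * ξ) * Complex.I) • weightedOrbit T φ z v := by
  refine Continuous.integrable_of_hasCompactSupport ?_ ?_
  · exact Continuous.smul (by fun_prop) (h.continuous_weightedOrbit hφc z)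
  · exact (hasCompactSupport_weightedOrbit hφ z).smul_left

theorem integral_by_parts_orbit [CompleteSpace H] (h : IsBoundedSemigroup A T R C)
    {c c' : ℝ → ℂ} {b : ℝ} (hb : 0 < b) (hc : ∀ s, HasDerivAt c (c' s) s) (hc' : Continuous c')
    (h0 : ∀ s, s ∉ Set.Ioo 0 b → c s = 0) (h0' : ∀ s, s ∉ Set.Ioo 0 b → c' s = 0)
    (x : A.domain) :
    ∫ s, (c s • T (max s 0) (A x) + c' s • T (max s 0) (x : H)) = 0 := by
  have hcc : Continuous c := continuous_iff_continuousAt.2 fun s => (hc s).continuousAt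
  rw [← intervalIntegral.integral_eq_integral_of_support_subset (a := 0) (b := b)]
  · rw [intervalIntegral.integral_eq_sub_of_hasDeriv_right_of_le
      (f := fun s => c s • T (max s 0) (x : H)) hb.le]
    · simp [h0 0, h0 b]
    · exact (hcc.smul (h.continuous_orbit _)).continuousOn
    · intro s hs
      have h1 : HasDerivWithinAt (fun t => T (max t 0) (x : H)) (T s (A x)) (Set.Ioi s) s := by
        refine ((h.hasDerivWithinAt_orbit_domain x hs.1.le).mono Set.Ioi_subset_Ici_self).congr
          (fun t ht => ?_) ?_
        · rw [max_eq_left (hs.1.le.trans (le_of_lt ht))]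
        · rw [max_eq_left hs.1.le]
      have h2 := (hc s).hasDerivWithinAt (s := Set.Ioi s)
      have h3 := h2.smul h1
      rw [max_eq_left hs.1.le] at h3
      rw [max_eq_left hs.1.le]
      exact h3
    · exact ((hcc.smul (h.continuous_orbit _)).add
        (hc'.smul (h.continuous_orbit _))).intervalIntegrable _ _
  · intro s hs
    by_contra hn
    have : s ∉ Set.Ioo 0 b := fun h' => hn ⟨h'.1, h'.2.le⟩
    simp [h0 s this, h0' s this] at hs

open FourierTransform in
theorem fourier_weightedOrbit_domain [CompleteSpace H] (h : IsBoundedSemigroup A T R C)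
    {φ φ' : ℝ → ℝ} {b : ℝ} (hb : 0 < b) (hφ : ∀ s, HasDerivAt φ (φ' s) s) (hφ' : Continuous φ')
    (h0 : ∀ s, s ∉ Set.Ioo 0 b → φ s = 0) (h0' : ∀ s, s ∉ Set.Ioo 0 b → φ' s = 0)
    (x : A.domain) (ξ : ℝ) :
    (Complex.I * ↑(2 * Real.pi * ξ)) • 𝓕 (weightedOrbit T φ (x : H)) ξ =
      𝓕 (weightedOrbit T φ' (x : H)) ξ + 𝓕 (weightedOrbit T φ (A x)) ξ := by
  have hφc : Continuous φ := continuous_iff_continuousAt.2 fun s => (hφ s).continuousAt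
  have hexp : ∀ s : ℝ, HasDerivAt
      (fun v : ℝ => Complex.exp (↑(-2 * Real.pi * v * ξ) * Complex.I))
      (Complex.exp (↑(-2 * Real.pi * s * ξ) * Complex.I) *
        (-(Complex.I * ↑(2 * Real.pi * ξ)))) s := by
    intro s
    have h1 : HasDerivAt (fun v : ℝ => -2 * Real.pi * v * ξ) (-2 * Real.pi * 1 * ξ) s :=
      ((hasDerivAt_id s).const_mul _).mul_const _
    refine (h1.ofReal_comp.mul_const Complex.I).cexp.congr_deriv ?_
    push_cast
    ring
  have key := h.integral_by_parts_orbit hb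
    (fun s => (hexp s).mul (hφ s).ofReal_comp) (by fun_prop)
    (fun s hs => by simp [h0 s hs]) (fun s hs => by simp [h0 s hs, h0' s hs]) x
  simp only [Real.fourier_real_eq_integral_exp_smul]
  have i1 := h.integrable_exp_smul_weightedOrbit hφ' h0' (x : H) ξ
  have i2 := h.integrable_exp_smul_weightedOrbit hφc h0 (A x) ξ
  have i3 := (h.integrable_exp_smul_weightedOrbit hφc h0 (x : H) ξ).smul
    (Complex.I * ↑(2 * Real.pi * ξ))
  rw [← MeasureTheory.integral_smul, ← MeasureTheory.integral_add i1 i2, eq_comm, ← sub_eq_zero]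
  refine (MeasureTheory.integral_sub (i1.add i2) i3).symm.trans (Eq.trans ?_ key)
  congr 1
  ext s
  simp only [weightedOrbit, Pi.smul_apply, Pi.add_apply, Pi.mul_apply]
  module

open FourierTransform in
theorem fourier_weightedOrbit [CompleteSpace H] (h : IsBoundedSemigroup A T R C)
    {φ φ' : ℝ → ℝ} {b : ℝ} (hb : 0 < b) (hφ : ∀ s, HasDerivAt φ (φ' s) s) (hφ' : Continuous φ')
    (h0 : ∀ s, s ∉ Set.Ioo 0 b → φ s = 0) (h0' : ∀ s, s ∉ Set.Ioo 0 b → φ' s = 0)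
    (z : H) (ξ : ℝ) :
    𝓕 (weightedOrbit T φ z) ξ = R (2 * Real.pi * ξ) (𝓕 (weightedOrbit T φ' z) ξ) := by
  have hφc : Continuous φ := continuous_iff_continuousAt.2 fun s => (hφ s).continuousAt
  obtain ⟨hD, hA⟩ := (h.resolvent (2 * Real.pi * ξ)).2 z
  have h1 := h.fourier_weightedOrbit_domain hb hφ hφ' h0 h0' ⟨_, hD⟩ ξ
  have h2 : R (2 * Real.pi * ξ) (𝓕 (weightedOrbit T φ' z) ξ) =
      𝓕 (weightedOrbit T φ' (R (2 * Real.pi * ξ) z)) ξ := by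
    simp only [Real.fourier_real_eq_integral_exp_smul]
    rw [← ContinuousLinearMap.integral_comp_comm _
      (h.integrable_exp_smul_weightedOrbit hφ' h0' z ξ)]
    congr 1
    ext s
    simp [weightedOrbit, h.resolvent_comm _ (le_max_right s 0)]
  rw [h2, ← sub_eq_iff_eq_add.2 h1]
  simp only [Real.fourier_real_eq_integral_exp_smul]
  rw [← MeasureTheory.integral_smul]
  refine Eq.trans ?_ (MeasureTheory.integral_sub
    ((h.integrable_exp_smul_weightedOrbit hφc h0 _ ξ).smul _)
    (h.integrable_exp_smul_weightedOrbit hφc h0 _ ξ))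
  congr 1
  ext s
  have h3 : T (max s 0) z = (Complex.I * ↑(2 * Real.pi * ξ)) •
      T (max s 0) (R (2 * Real.pi * ξ) z) - T (max s 0) (A ⟨_, hD⟩) := by
    rw [← map_smul, ← map_sub, hA]
  simp only [weightedOrbit]
  rw [h3]
  module

end IsBoundedSemigroup

open MeasureTheory in
theorem eLpNorm_two_le_sum_of_norm_le {H ι : Type*} [NormedAddCommGroup H] (S : Finset ι)
    {u : ℝ → H} {v : ι → ℝ → H} {a : ι → ℝ} (ha : ∀ i, 0 ≤ a i)
    (hv : ∀ i, AEStronglyMeasurable (v i) volume)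
    (h : ∀ ξ, ‖u ξ‖ ≤ ∑ i ∈ S, a i * ‖v i ξ‖) :
    eLpNorm u 2 volume ≤ ∑ i ∈ S, ENNReal.ofReal (a i) * eLpNorm (v i) 2 volume := by
  let w : ι → ℝ → ℝ := fun i => a i • fun ξ => ‖v i ξ‖
  have hw : ∀ i ∈ S, AEStronglyMeasurable (w i) volume := fun i _ => (hv i).norm.const_smul (a i)
  have h1 : ∀ ξ, ‖u ξ‖ ≤ (∑ i ∈ S, w i) ξ := fun ξ => by simpa [w] using h ξ
  refine (eLpNorm_mono_real h1).trans ((eLpNorm_sum_le hw one_le_two).trans_eq ?_)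
  refine Finset.sum_congr rfl fun i _ => ?_
  rw [eLpNorm_const_smul, eLpNorm_norm, Real.enorm_of_nonneg (ha i)]

open MeasureTheory FourierTransform in
theorem toReal_eLpNorm_le_sum_of_fourier_le {H ι : Type*} [NormedAddCommGroup H]
    [InnerProductSpace ℂ H] [CompleteSpace H] (S : Finset ι) {f : ℝ → H} {g : ι → ℝ → H}
    {a : ι → ℝ} (ha : ∀ i, 0 ≤ a i) (hf : Integrable f) (hf2 : MemLp f 2)
    (hg : ∀ i, Integrable (g i)) (hg2 : ∀ i, MemLp (g i) 2)
    (h : ∀ ξ, ‖𝓕 f ξ‖ ≤ ∑ i ∈ S, a i * ‖𝓕 (g i) ξ‖) :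
    (eLpNorm f 2).toReal ≤ ∑ i ∈ S, a i * (eLpNorm (g i) 2).toReal := by
  have hmeas : ∀ i, AEStronglyMeasurable (𝓕 (g i)) volume := fun i =>
    (VectorFourier.fourierIntegral_continuous Real.continuous_fourierChar
      continuous_inner (hg i)).aestronglyMeasurable
  have h1 := eLpNorm_two_le_sum_of_norm_le S ha hmeas h
  rw [eLpNorm_fourier hf hf2, Finset.sum_congr rfl fun i _ => by
    rw [eLpNorm_fourier (hg i) (hg2 i)]] at h1
  have h2 : ∀ i ∈ S, ENNReal.ofReal (a i) * eLpNorm (g i) 2 ≠ ⊤ := fun i _ =>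
    ENNReal.mul_ne_top ENNReal.ofReal_ne_top (hg2 i).2.ne
  refine (ENNReal.toReal_mono (ENNReal.sum_ne_top.2 h2) h1).trans_eq ?_
  rw [ENNReal.toReal_sum h2]
  refine Finset.sum_congr rfl fun i _ => ?_
  rw [ENNReal.toReal_mul, ENNReal.toReal_ofReal (ha i)]

open MeasureTheory in
theorem toReal_eLpNorm_two_indicator_Icc_const {a b c : ℝ} (hc : 0 ≤ c) (hab : a ≤ b) :
    (eLpNorm ((Set.Icc a b).indicator fun _ => c) 2 volume).toReal = c * √(b - a) := by
  rw [eLpNorm_indicator_const measurableSet_Icc (by norm_num) (by norm_num),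
    Real.enorm_of_nonneg hc, Real.volume_Icc, ENNReal.toReal_mul, ENNReal.toReal_ofReal hc,
    ← ENNReal.toReal_rpow, ENNReal.toReal_ofReal (sub_nonneg.2 hab), Real.sqrt_eq_rpow]
  norm_num

theorem exists_iterated_deriv_cutoff (n : ℕ) : ∃ (P : ℕ → ℝ → ℝ) (m : ℝ), 0 ≤ m ∧
    (∀ j s, HasDerivAt (P j) (P (j + 1) s) s) ∧ (∀ j s, s ∉ Set.Ioo (0 : ℝ) 1 → P j s = 0) ∧
    (∀ s ∈ Set.Icc (1 / 4 : ℝ) (3 / 4), P 0 s = 1) ∧ ∀ j ≤ n, ∀ s, |P j s| ≤ m := by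
  let β : ContDiffBump (1 / 2 : ℝ) := ⟨1 / 4, 1 / 3, by norm_num, by norm_num⟩
  have hβ : ContDiff ℝ (⊤ : ℕ∞) β := β.contDiff
  have hsupp : ∀ j, tsupport (iteratedDeriv j β) ⊆ tsupport β := by
    intro j
    refine closure_minimal (fun s hs => ?_) isClosed_closure
    refine support_iteratedFDeriv_subset (𝕜 := ℝ) j ?_
    rw [Function.mem_support] at hs ⊢
    rwa [← norm_ne_zero_iff, norm_iteratedFDeriv_eq_norm_iteratedDeriv, norm_ne_zero_iff]
  have hcont : ∀ j, Continuous (iteratedDeriv j β) := fun j =>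
    hβ.continuous_iteratedDeriv j (by exact_mod_cast le_top)
  have hcpt : ∀ j, HasCompactSupport (iteratedDeriv j β) := fun j =>
    β.hasCompactSupport.of_isClosed_subset isClosed_closure (hsupp j)
  choose m hm using fun j => (hcpt j).exists_bound_of_continuous (hcont j)
  have hm0 : ∀ j, 0 ≤ m j := fun j => (norm_nonneg _).trans (hm j 0)
  refine ⟨fun j => iteratedDeriv j β, ∑ j ∈ Finset.range (n + 1), m j,
    Finset.sum_nonneg fun j _ => hm0 j, ?_, ?_, ?_, ?_⟩
  · intro j s
    change HasDerivAt (iteratedDeriv j β) (iteratedDeriv (j + 1) β s) s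
    rw [iteratedDeriv_succ]
    exact ((hβ.differentiable_iteratedDeriv j (by exact_mod_cast ENat.natCast_lt_top j)) s).hasDerivAt
  · intro j s hs
    refine image_eq_zero_of_notMem_tsupport fun hs' => hs ?_
    have := hsupp j hs'
    rw [β.tsupport_eq, Metric.mem_closedBall, Real.dist_eq, abs_le] at this
    simp only [β] at this
    constructor <;> linarith [this.1, this.2]
  · intro s hs
    change iteratedDeriv 0 β s = 1
    rw [iteratedDeriv_zero]
    refine β.one_of_mem_closedBall ?_
    rw [Metric.mem_closedBall, Real.dist_eq, abs_le]
    simp only [β]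
    constructor <;> linarith [hs.1, hs.2]
  · intro j hj s
    exact (hm j s).trans (Finset.single_le_sum (fun i _ => hm0 i) (Finset.mem_range.2 (by omega)))

namespace IsBoundedSemigroup

variable {H : Type*} [NormedAddCommGroup H] [InnerProductSpace ℂ H]
  {A : H →ₗ.[ℂ] H} {T : ℝ → H →L[ℂ] H} {R : ℝ → H →L[ℂ] H} {C : ℝ}

open MeasureTheory in
theorem memLp_weightedOrbit (h : IsBoundedSemigroup A T R C) {φ : ℝ → ℝ} {b : ℝ}
    (hφc : Continuous φ) (hφ : ∀ s, s ∉ Set.Ioo 0 b → φ s = 0) (z : H) (p : ENNReal) :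
    MemLp (weightedOrbit T φ z) p :=
  (h.continuous_weightedOrbit hφc z).memLp_of_hasCompactSupport
    (hasCompactSupport_weightedOrbit hφ z)

open MeasureTheory in
theorem toReal_eLpNorm_weightedOrbit_le (h : IsBoundedSemigroup A T R C) {φ : ℝ → ℝ} {b m : ℝ}
    (hb : 0 ≤ b) (hm : 0 ≤ m) (hφ : ∀ s, s ∉ Set.Ioo 0 b → φ s = 0) (hφm : ∀ s, |φ s| ≤ m)
    (z : H) :
    (eLpNorm (weightedOrbit T φ z) 2).toReal ≤ m * (C * ‖z‖) * √b := by
  have hc : 0 ≤ m * (C * ‖z‖) := by have := h.one_le; positivity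
  have h1 := toReal_eLpNorm_two_indicator_Icc_const hc hb
  rw [sub_zero] at h1
  rw [← h1]
  refine ENNReal.toReal_mono ?_ (eLpNorm_mono_real fun s => ?_)
  · exact (memLp_indicator_const 2 measurableSet_Icc _ (Or.inr (by simp))).2.ne
  · by_cases hs : s ∈ Set.Icc 0 b
    · rw [Set.indicator_of_mem hs, weightedOrbit, norm_smul, Complex.norm_real]
      gcongr
      · exact hφm s
      · exact (T _).le_of_opNorm_le (h.bound _ (le_max_right _ _)) z
    · rw [Set.indicator_of_notMem hs, weightedOrbit,
        hφ s fun hs' => hs ⟨hs'.1.le, hs'.2.le⟩]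
      simp

open MeasureTheory in
theorem norm_le_toReal_eLpNorm_weightedOrbit (h : IsBoundedSemigroup A T R C) {φ : ℝ → ℝ}
    {a b t : ℝ} (hφc : Continuous φ) (hφ : ∀ s, s ∉ Set.Ioo 0 t → φ s = 0) (ha : 0 ≤ a)
    (hab : a ≤ b) (hbt : b ≤ t) (hφ1 : ∀ s ∈ Set.Icc a b, φ s = 1) (z : H) :
    ‖T t z‖ * √(b - a) ≤ C * (eLpNorm (weightedOrbit T φ z) 2).toReal := by
  have hC : 0 < C := by linarith [h.one_le]
  have hc : 0 ≤ C⁻¹ * ‖T t z‖ := by positivity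
  have h1 : C⁻¹ * ‖T t z‖ * √(b - a) ≤ (eLpNorm (weightedOrbit T φ z) 2).toReal := by
    rw [← toReal_eLpNorm_two_indicator_Icc_const hc hab]
    refine ENNReal.toReal_mono (h.memLp_weightedOrbit hφc hφ z 2).2.ne (eLpNorm_mono fun s => ?_)
    by_cases hs : s ∈ Set.Icc a b
    · have hs0 : 0 ≤ s := ha.trans hs.1
      have hst : 0 ≤ t - s := by linarith [hs.2]
      rw [Set.indicator_of_mem hs, weightedOrbit, hφ1 s hs, max_eq_left hs0,
        Real.norm_of_nonneg hc, Complex.ofReal_one, one_smul, inv_mul_le_iff₀ hC]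
      have h2 := h.add (t - s) s hst hs0
      rw [sub_add_cancel] at h2
      rw [h2]
      exact (T (t - s)).le_of_opNorm_le (h.bound _ hst) _
    · rw [Set.indicator_of_notMem hs]
      simp
  rw [mul_assoc, inv_mul_le_iff₀ hC] at h1
  exact h1

end IsBoundedSemigroup

theorem le_sum_of_mul_le_of_le_pow_mul {α t ω r L₀ W W' V V₁ U U₁ : ℝ} {k : ℕ} (hα : 0 < α)
    (hk : 1 ≤ k * α) (ht : 1 ≤ t) (hω : 0 ≤ ω) (hr : 0 ≤ r) (hL₀ : 1 ≤ L₀)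
    (hrω : r ≤ L₀ * (1 + ω) ^ α) (hV : 0 ≤ V) (hV₁ : 0 ≤ V₁)
    (hU : 0 ≤ U) (hU₁ : 0 ≤ U₁) (hW' : 0 ≤ W')
    (hWW' : W ≤ r ^ k * W') (hW : ω * W ≤ V + U) (hVV : V ≤ r ^ k * V₁) (hUU : U ≤ r ^ k * U₁) :
    W ≤ (L₀ * 2 ^ α) ^ k * W' + (L₀ * 2 ^ α) ^ k * t ^ k * t ^ (-(1 / α)) * V₁ +
      (L₀ * 2 ^ α) ^ k * t ^ k * t ^ (-(1 / α)) * U₁ + t ^ (-(1 / α)) * V +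
      t ^ (-(1 / α)) * U := by
  have ht0 : 0 < t := by linarith
  set L := (L₀ * 2 ^ α) ^ k with hL
  set q := t ^ (-(1 / α)) with hq
  have hq0 : 0 < q := by positivity
  have hL0 : 0 ≤ L := by positivity
  have e1 : 0 ≤ L * W' := by positivity
  have e2 : 0 ≤ L * t ^ k * q * V₁ := by positivity
  have e3 : 0 ≤ L * t ^ k * q * U₁ := by positivity
  have e4 : 0 ≤ q * V := by positivity
  have e5 : 0 ≤ q * U := by positivity
  rcases le_total ω 1 with h1 | h1
  · have h2 : r ^ k ≤ L := by
      rw [hL]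
      gcongr
      refine hrω.trans ?_
      gcongr
      linarith
    have : W ≤ L * W' := hWW'.trans (by gcongr)
    linarith
  rcases le_total (ω * q) 1 with h2 | h2
  · have hω0 : 0 < ω := by linarith
    have hqt : q * t ^ (1 / α) = 1 := by
      rw [hq, ← Real.rpow_add ht0]; simp
    have hωα : ω ^ α = (ω * q) ^ α * t := by
      have : ω = (ω * q) * t ^ (1 / α) := by rw [mul_assoc, hqt, mul_one]
      conv_lhs => rw [this]
      rw [Real.mul_rpow (by positivity) (by positivity), ← Real.rpow_mul ht0.le,
        one_div_mul_cancel hα.ne', Real.rpow_one]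
    have hθ : ((ω * q) ^ α) ^ k ≤ ω * q := by
      rw [← Real.rpow_natCast, ← Real.rpow_mul (by positivity)]
      calc (ω * q) ^ (α * k) ≤ (ω * q) ^ (1 : ℝ) :=
            Real.rpow_le_rpow_of_exponent_ge (by positivity) h2 (by linarith)
        _ = _ := Real.rpow_one _
    have h3 : r ^ k ≤ ω * (L * t ^ k * q) := by
      calc r ^ k ≤ (L₀ * 2 ^ α * ω ^ α) ^ k := by
            gcongr
            refine hrω.trans ?_
            rw [mul_assoc, ← Real.mul_rpow (by norm_num) hω]
            gcongr
            linarith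
        _ = L * (((ω * q) ^ α) ^ k * t ^ k) := by rw [hωα, mul_pow, mul_pow _ t]
        _ ≤ L * ((ω * q) * t ^ k) := by gcongr
        _ = _ := by ring
    have h4 : ω * W ≤ ω * (L * t ^ k * q * V₁ + L * t ^ k * q * U₁) := by
      calc ω * W ≤ r ^ k * V₁ + r ^ k * U₁ := by linarith
        _ ≤ ω * (L * t ^ k * q) * V₁ + ω * (L * t ^ k * q) * U₁ := by gcongr
        _ = _ := by ring
    have := le_of_mul_le_mul_left h4 hω0
    linarith
  · rcases le_total W 0 with h3 | h3
    · linarith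
    have h4 : W ≤ q * (ω * W) := by nlinarith
    have h5 : q * (ω * W) ≤ q * (V + U) := by gcongr
    linarith

namespace IsBoundedSemigroup

variable {H : Type*} [NormedAddCommGroup H] [InnerProductSpace ℂ H]
  {A : H →ₗ.[ℂ] H} {T : ℝ → H →L[ℂ] H} {R : ℝ → H →L[ℂ] H} {C : ℝ}

open FourierTransform in
theorem norm_fourier_weightedOrbit_le [CompleteSpace H] (h : IsBoundedSemigroup A T R C)
    {φ : ℕ → ℝ → ℝ} {b : ℝ} (hb : 0 < b) (hφ : ∀ j s, HasDerivAt (φ j) (φ (j + 1) s) s)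
    (h0 : ∀ j s, s ∉ Set.Ioo 0 b → φ j s = 0) (z : H) (ξ : ℝ) (j k : ℕ) :
    ‖𝓕 (weightedOrbit T (φ j) z) ξ‖ ≤
      ‖R (2 * Real.pi * ξ)‖ ^ k * ‖𝓕 (weightedOrbit T (φ (j + k)) z) ξ‖ := by
  induction k with
  | zero => simp
  | succ k ih =>
    refine ih.trans ?_
    have hc : Continuous (φ (j + k + 1)) :=
      continuous_iff_continuousAt.2 fun s => (hφ _ s).continuousAt
    rw [h.fourier_weightedOrbit hb (hφ (j + k)) hc (h0 _) (h0 _) z ξ, pow_succ,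
      mul_assoc (_ ^ k)]
    gcongr
    exact (R _).le_opNorm _

open FourierTransform in
theorem norm_fourier_weightedOrbit_le_sum [CompleteSpace H] (h : IsBoundedSemigroup A T R C)
    {φ : ℕ → ℝ → ℝ} {t α L₀ : ℝ} {k : ℕ} (hα : 0 < α) (hk : 1 ≤ k * α) (ht : 1 ≤ t)
    (hL₀ : 1 ≤ L₀) (hR : ∀ s, ‖R s‖ ≤ L₀ * (1 + |s|) ^ α)
    (hφ : ∀ j s, HasDerivAt (φ j) (φ (j + 1) s) s)
    (h0 : ∀ j s, s ∉ Set.Ioo 0 t → φ j s = 0) (x : A.domain) (ξ : ℝ) :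
    ‖𝓕 (weightedOrbit T (φ 0) (x : H)) ξ‖ ≤
      (L₀ * 2 ^ α) ^ k * ‖𝓕 (weightedOrbit T (φ k) (x : H)) ξ‖ +
      (L₀ * 2 ^ α) ^ k * t ^ k * t ^ (-(1 / α)) *
        ‖𝓕 (weightedOrbit T (φ (1 + k)) (x : H)) ξ‖ +
      (L₀ * 2 ^ α) ^ k * t ^ k * t ^ (-(1 / α)) * ‖𝓕 (weightedOrbit T (φ k) (A x)) ξ‖ +
      t ^ (-(1 / α)) * ‖𝓕 (weightedOrbit T (φ 1) (x : H)) ξ‖ +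
      t ^ (-(1 / α)) * ‖𝓕 (weightedOrbit T (φ 0) (A x)) ξ‖ := by
  have ht0 : 0 < t := by linarith
  have hc : Continuous (φ 1) := continuous_iff_continuousAt.2 fun s => (hφ 1 s).continuousAt
  have e0 := h.norm_fourier_weightedOrbit_le ht0 hφ h0 (x : H) ξ 0 k
  have e1 := h.norm_fourier_weightedOrbit_le ht0 hφ h0 (x : H) ξ 1 k
  have e2 := h.norm_fourier_weightedOrbit_le ht0 hφ h0 (A x) ξ 0 k
  have e3 := congrArg norm
    (h.fourier_weightedOrbit_domain ht0 (hφ 0) hc (h0 0) (h0 1) x ξ)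
  rw [norm_smul, norm_mul, Complex.norm_I, one_mul, Complex.norm_real, Real.norm_eq_abs] at e3
  rw [zero_add] at e0 e2
  exact le_sum_of_mul_le_of_le_pow_mul hα hk ht (abs_nonneg _) (norm_nonneg _) hL₀
    (hR (2 * Real.pi * ξ)) (by positivity) (by positivity) (by positivity) (by positivity)
    (by positivity) e0 (e3.trans_le (norm_add_le _ _)) e1 e2

theorem norm_apply_le_of_resolvent_bound [CompleteSpace H] (h : IsBoundedSemigroup A T R C)
    {P : ℕ → ℝ → ℝ} {t α L₀ m : ℝ} {k : ℕ} (hα : 0 < α) (hk : 1 ≤ k * α) (ht : 1 ≤ t)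
    (hL₀ : 1 ≤ L₀) (hR : ∀ s, ‖R s‖ ≤ L₀ * (1 + |s|) ^ α) (hm : 0 ≤ m)
    (hP : ∀ j s, HasDerivAt (P j) (P (j + 1) s) s)
    (hP0 : ∀ j s, s ∉ Set.Ioo (0 : ℝ) 1 → P j s = 0)
    (hP1 : ∀ s ∈ Set.Icc (1 / 4 : ℝ) (3 / 4), P 0 s = 1)
    (hPm : ∀ j ≤ k + 1, ∀ s, |P j s| ≤ m) (x : A.domain) :
    ‖T t (x : H)‖ ≤ 6 * C ^ 2 * ((L₀ * 2 ^ α) ^ k + 1) * m * t ^ (-(1 / α)) *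
      (‖(x : H)‖ + ‖A x‖) := by
  have ht0 : 0 < t := by linarith
  have hC := h.one_le
  set L := (L₀ * 2 ^ α) ^ k with hL
  set q := t ^ (-(1 / α)) with hq
  have hq0 : 0 < q := by positivity
  have hL0 : 0 ≤ L := by positivity
  let φ : ℕ → ℝ → ℝ := fun j s => t⁻¹ ^ j * P j (s / t)
  have hφ : ∀ j s, HasDerivAt (φ j) (φ (j + 1) s) s := by
    intro j s
    have h1 := ((hP j (s / t)).comp s ((hasDerivAt_id s).div_const t)).const_mul (t⁻¹ ^ j)
    refine h1.congr_deriv ?_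
    simp only [φ, pow_succ]
    ring
  have hφ0 : ∀ j s, s ∉ Set.Ioo 0 t → φ j s = 0 := by
    intro j s hs
    have : s / t ∉ Set.Ioo (0 : ℝ) 1 := fun h' =>
      hs ⟨(div_pos_iff_of_pos_right ht0).1 h'.1, (div_lt_one ht0).1 h'.2⟩
    simp [φ, hP0 j _ this]
  have hφm : ∀ j ≤ k + 1, ∀ s, |φ j s| ≤ t⁻¹ ^ j * m := by
    intro j hj s
    rw [abs_mul, abs_of_nonneg (by positivity)]
    gcongr
    exact hPm j hj _
  have hφ1 : ∀ s ∈ Set.Icc (t / 4) (3 * t / 4), φ 0 s = 1 := by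
    intro s hs
    simp only [φ, pow_zero, one_mul]
    refine hP1 _ ⟨?_, ?_⟩
    · rw [le_div_iff₀ ht0]; linarith [hs.1]
    · rw [div_le_iff₀ ht0]; linarith [hs.2]
  have hφc : ∀ j, Continuous (φ j) := fun j =>
    continuous_iff_continuousAt.2 fun s => (hφ j s).continuousAt
  have hmem : ∀ j z, MeasureTheory.MemLp (weightedOrbit T (φ j) z) 2 := fun j z =>
    h.memLp_weightedOrbit (hφc j) (hφ0 j) z 2
  have hint : ∀ j z, MeasureTheory.Integrable (weightedOrbit T (φ j) z) := fun j z =>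
    MeasureTheory.memLp_one_iff_integrable.1 (h.memLp_weightedOrbit (hφc j) (hφ0 j) z 1)
  have hN : ∀ j ≤ k + 1, ∀ z, (MeasureTheory.eLpNorm (weightedOrbit T (φ j) z) 2).toReal ≤
      t⁻¹ ^ j * m * (C * ‖z‖) * √t := fun j hj z =>
    h.toReal_eLpNorm_weightedOrbit_le ht0.le (by positivity) (hφ0 j) (hφm j hj) z
  have hsum := toReal_eLpNorm_le_sum_of_fourier_le (ι := Fin 5) Finset.univ
    (f := weightedOrbit T (φ 0) (x : H))
    (g := ![weightedOrbit T (φ k) (x : H), weightedOrbit T (φ (1 + k)) (x : H),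
      weightedOrbit T (φ k) (A x), weightedOrbit T (φ 1) (x : H), weightedOrbit T (φ 0) (A x)])
    (a := ![L, L * t ^ k * q, L * t ^ k * q, q, q])
    (by intro i; fin_cases i <;> simp <;> positivity) (hint _ _) (hmem _ _)
    (by intro i; fin_cases i <;> exact hint _ _)
    (by intro i; fin_cases i <;> exact hmem _ _)
    (by
      intro ξ
      rw [Fin.sum_univ_five]
      exact h.norm_fourier_weightedOrbit_le_sum hα hk ht hL₀ hR hφ hφ0 x ξ)
  rw [Fin.sum_univ_five] at hsum
  replace hsum : (MeasureTheory.eLpNorm (weightedOrbit T (φ 0) (x : H)) 2).toReal ≤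
      L * (MeasureTheory.eLpNorm (weightedOrbit T (φ k) (x : H)) 2).toReal +
      L * t ^ k * q * (MeasureTheory.eLpNorm (weightedOrbit T (φ (1 + k)) (x : H)) 2).toReal +
      L * t ^ k * q * (MeasureTheory.eLpNorm (weightedOrbit T (φ k) (A x)) 2).toReal +
      q * (MeasureTheory.eLpNorm (weightedOrbit T (φ 1) (x : H)) 2).toReal +
      q * (MeasureTheory.eLpNorm (weightedOrbit T (φ 0) (A x)) 2).toReal := hsum
  have hti : t⁻¹ ≤ 1 := inv_le_one_of_one_le₀ ht
  have htk : t⁻¹ ^ k ≤ q := by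
    rw [inv_pow, ← Real.rpow_natCast, ← Real.rpow_neg ht0.le, hq]
    refine Real.rpow_le_rpow_of_exponent_le ht (neg_le_neg ?_)
    rwa [div_le_iff₀ hα]
  have hkk : t ^ k * t⁻¹ ^ k = 1 := by rw [← mul_pow, mul_inv_cancel₀ ht0.ne', one_pow]
  set X := m * (C * ‖(x : H)‖) * √t with hX
  set Z := m * (C * ‖A x‖) * √t with hZ
  have hX0 : 0 ≤ X := by positivity
  have hZ0 : 0 ≤ Z := by positivity
  have b1 : L * (MeasureTheory.eLpNorm (weightedOrbit T (φ k) (x : H)) 2).toReal ≤ L * q * X := by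
    calc _ ≤ L * (t⁻¹ ^ k * m * (C * ‖(x : H)‖) * √t) := by gcongr; exact hN k (by omega) _
      _ = L * t⁻¹ ^ k * X := by rw [hX]; ring
      _ ≤ _ := by gcongr
  have b2 : L * t ^ k * q * (MeasureTheory.eLpNorm (weightedOrbit T (φ (1 + k)) (x : H)) 2).toReal ≤
      L * q * X := by
    calc _ ≤ L * t ^ k * q * (t⁻¹ ^ (1 + k) * m * (C * ‖(x : H)‖) * √t) := by
          gcongr; exact hN (1 + k) (by omega) _
      _ = L * q * (t ^ k * t⁻¹ ^ k) * (t⁻¹ * X) := by rw [hX]; ring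
      _ ≤ L * q * 1 * (1 * X) := by rw [hkk]; gcongr
      _ = _ := by ring
  have b3 : L * t ^ k * q * (MeasureTheory.eLpNorm (weightedOrbit T (φ k) (A x)) 2).toReal ≤
      L * q * Z := by
    calc _ ≤ L * t ^ k * q * (t⁻¹ ^ k * m * (C * ‖A x‖) * √t) := by
          gcongr; exact hN k (by omega) _
      _ = L * q * (t ^ k * t⁻¹ ^ k) * Z := by rw [hZ]; ring
      _ = _ := by rw [hkk]; ring
  have b4 : q * (MeasureTheory.eLpNorm (weightedOrbit T (φ 1) (x : H)) 2).toReal ≤ q * X := by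
    calc _ ≤ q * (t⁻¹ ^ 1 * m * (C * ‖(x : H)‖) * √t) := by gcongr; exact hN 1 (by omega) _
      _ = q * (t⁻¹ * X) := by rw [hX]; ring
      _ ≤ q * (1 * X) := by gcongr
      _ = _ := by ring
  have b5 : q * (MeasureTheory.eLpNorm (weightedOrbit T (φ 0) (A x)) 2).toReal ≤ q * Z := by
    calc _ ≤ q * (t⁻¹ ^ 0 * m * (C * ‖A x‖) * √t) := by gcongr; exact hN 0 (by omega) _
      _ = _ := by rw [hZ]; ring
  have htot : (MeasureTheory.eLpNorm (weightedOrbit T (φ 0) (x : H)) 2).toReal ≤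
      3 * (L + 1) * q * (X + Z) := by
    have f1 : 0 ≤ L * q * X := by positivity
    have f2 : 0 ≤ L * q * Z := by positivity
    have f3 : 0 ≤ q * X := by positivity
    have f4 : 0 ≤ q * Z := by positivity
    linarith
  have hlow := h.norm_le_toReal_eLpNorm_weightedOrbit (hφc 0) (hφ0 0)
    (a := t / 4) (b := 3 * t / 4) (by positivity) (by linarith) (by linarith) hφ1 (x : H)
  have hsq : √t ≤ 2 * √(3 * t / 4 - t / 4) := by
    refine Real.sqrt_le_iff.2 ⟨by positivity, ?_⟩
    rw [mul_pow, Real.sq_sqrt (by linarith)]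
    linarith
  have hst : 0 < √t := Real.sqrt_pos.2 ht0
  refine le_of_mul_le_mul_right ?_ hst
  calc ‖T t (x : H)‖ * √t ≤ ‖T t (x : H)‖ * (2 * √(3 * t / 4 - t / 4)) := by gcongr
    _ = 2 * (‖T t (x : H)‖ * √(3 * t / 4 - t / 4)) := by ring
    _ ≤ 2 * (C * (3 * (L + 1) * q * (X + Z))) :=
      mul_le_mul_of_nonneg_left (hlow.trans (by gcongr)) zero_le_two
    _ = _ := by rw [hX, hZ]; ring

end IsBoundedSemigroup

/-- Borichev–Tomilov type conclusion: let `A` generate a bounded C₀-semigroup `(T(t))` on a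
Hilbert space with `iℝ ⊂ ρ(A)`, witnessed by a resolvent family `R s = (isI − A)⁻¹`, and
suppose `‖R s‖ = O(|s|^α)` as `|s| → ∞`. Then `‖T(t)A⁻¹‖ = O(t^{−1/α})`; in particular for
every `Φ₀ ∈ D(A)`, `‖T(t)Φ₀‖ ≤ M t^{−1/α} ‖Φ₀‖_{D(A)}` for `t > 0`. -/
theorem stmt9 {H : Type*} [NormedAddCommGroup H] [InnerProductSpace ℂ H] [CompleteSpace H]
    (A : H →ₗ.[ℂ] H) (T : ℝ → H →L[ℂ] H)
    -- C₀-semigroup properties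
    (hT0 : T 0 = ContinuousLinearMap.id ℂ H)
    (hTsem : ∀ s t : ℝ, 0 ≤ s → 0 ≤ t → T (s + t) = (T s).comp (T t))
    (hTcont : ∀ x : H, ContinuousOn (fun t => T t x) (Set.Ici 0))
    -- boundedness of the semigroup
    (Mb : ℝ) (hMb : ∀ t : ℝ, 0 ≤ t → ‖T t‖ ≤ Mb)
    -- A is the generator
    (hgen : ∀ x : A.domain, HasDerivAt (fun t => T t (x : H)) (A x) 0)
    -- iℝ ⊂ ρ(A), with resolvent family R
    (R : ℝ → H →L[ℂ] H)
    (hR : ∀ s : ℝ, (∀ x : A.domain, R s ((Complex.I * s) • (x : H) - A x) = (x : H)) ∧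
        ∀ y : H, ∃ h : R s y ∈ A.domain,
          (Complex.I * s) • (R s y) - A ⟨R s y, h⟩ = y)
    -- resolvent growth: ‖R(is)‖ = O(|s|^α)
    (α : ℝ) (hα : 0 < α)
    (hRbd : ∃ K s₀ : ℝ, 0 < K ∧ 0 < s₀ ∧ ∀ s : ℝ, s₀ ≤ |s| → ‖R s‖ ≤ K * |s| ^ α) :
    ∃ M : ℝ, 0 < M ∧ ∀ t : ℝ, 0 < t → ∀ x : A.domain,
      ‖T t (x : H)‖ ≤ M * t ^ (-(1 / α)) * (‖(x : H)‖ + ‖A x‖) := by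
  obtain ⟨K, s₀, -, -, hK⟩ := hRbd
  have hMb0 : 0 ≤ Mb := (norm_nonneg _).trans (hMb 0 le_rfl)
  have h : IsBoundedSemigroup A T R (Mb + 1) :=
    ⟨hT0, hTsem, hTcont, by linarith, fun t ht => (hMb t ht).trans (by linarith), hgen, hR⟩
  obtain ⟨L₀, hL₀, hL⟩ := h.exists_resolvent_bound hα hK
  obtain ⟨k, hk⟩ := exists_nat_ge (1 / α)
  rw [div_le_iff₀ hα] at hk
  obtain ⟨P, m, hm, hP, hP0, hP1, hPm⟩ := exists_iterated_deriv_cutoff (k + 1)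
  have hC := h.one_le
  set D := 6 * (Mb + 1) ^ 2 * ((L₀ * 2 ^ α) ^ k + 1) * m with hD
  have hD0 : 0 ≤ D := by positivity
  refine ⟨D + (Mb + 1), by positivity, fun t ht x => ?_⟩
  rcases le_total 1 t with h1 | h1
  · refine (h.norm_apply_le_of_resolvent_bound hα hk h1 hL₀ hL hm hP hP0 hP1 hPm x).trans ?_
    gcongr
    linarith
  · have hq : 1 ≤ t ^ (-(1 / α)) :=
      Real.one_le_rpow_of_pos_of_le_one_of_nonpos ht h1 (neg_nonpos.2 (by positivity))
    calc ‖T t (x : H)‖ ≤ (Mb + 1) * ‖(x : H)‖ := (T t).le_of_opNorm_le (h.bound t ht.le) _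
      _ = (Mb + 1) * 1 * ‖(x : H)‖ := by ring
      _ ≤ (D + (Mb + 1)) * t ^ (-(1 / α)) * (‖(x : H)‖ + ‖A x‖) := by
        refine mul_le_mul (mul_le_mul (by linarith) hq zero_le_one (by linarith)) ?_
          (norm_nonneg _) (by positivity)
        linarith [norm_nonneg (A x)]
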